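/- (The semitransvectant of semi-invariants is a semi-invariant.) Let d ≥ 2, let m, k be natural numbers and let f, g ∈ ℂ[t, x_1, …, x_d] satisfy D1(f) = 0, (D1∘D2 − D2∘D1)(f) = m·f, D1(g) = 0, (D1∘D2 − D2∘D1)(g) = k·g. For 0 ≤ r ≤ min(m,k) set S = Σ_{i=0}^{r} (−1)^i · binom(r,i) · [m−i]_{r−i} · [k−r+i]_{i} · D2^i(f) · D2^{r−i}(g), where [a]_j denotes the falling factorial a(a−1)⋯(a−j+1). Then D1(S) = 0 and (D1∘D2 − D2∘D1)(S) = (m + k − 2r)·S. -/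

import Mathlib

open MvPolynomial Finset

/-- The derivation `D1 = t·∂/∂x₁ + 2x₁·∂/∂x₂ + ⋯ + d·x_{d−1}·∂/∂x_d` on
`ℂ[t, x₁, …, x_d]`, where the variable of index `0` is `t` and the variable of
index `j ≥ 1` is `x_j`. -/
noncomputable def D1 (d : ℕ) :
    Derivation ℂ (MvPolynomial (Fin (d + 1)) ℂ) (MvPolynomial (Fin (d + 1)) ℂ) :=
  MvPolynomial.mkDerivation ℂ (fun i =>
    if (i : ℕ) = 0 then 0
    else ((i : ℕ) : ℂ) •
      MvPolynomial.X (⟨(i : ℕ) - 1, lt_of_le_of_lt (Nat.sub_le _ _) i.isLt⟩ : Fin (d + 1)))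

/-- The derivation `D2 = d·x₁·∂/∂t + (d−1)·x₂·∂/∂x₁ + ⋯ + x_d·∂/∂x_{d−1}` on
`ℂ[t, x₁, …, x_d]`, where the variable of index `0` is `t` and the variable of
index `j ≥ 1` is `x_j`. -/
noncomputable def D2 (d : ℕ) :
    Derivation ℂ (MvPolynomial (Fin (d + 1)) ℂ) (MvPolynomial (Fin (d + 1)) ℂ) :=
  MvPolynomial.mkDerivation ℂ (fun i =>
    if h : (i : ℕ) < d then
      ((d - (i : ℕ) : ℕ) : ℂ) • MvPolynomial.X (⟨(i : ℕ) + 1, by omega⟩ : Fin (d + 1))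
    else 0)

theorem H_X (d : ℕ) (i : Fin (d+1)) :
    ⁅D1 d, D2 d⁆ (X i) = ((d:ℂ) - 2 * ((i:ℕ):ℂ)) • (X i : MvPolynomial (Fin (d + 1)) ℂ) := by
  rw [Derivation.commutator_apply]
  obtain ⟨i, hi⟩ := i
  have e1 : D1 d (D2 d (X ⟨i, hi⟩)) = (((d:ℂ) - i) * (i+1)) • (X ⟨i, hi⟩ : MvPolynomial (Fin (d + 1)) ℂ) := by
    by_cases h : i < d
    · simp [D1, D2, mkDerivation_X, h, smul_smul, Nat.cast_sub h.le]
    · have : i = d := by omega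
      subst this
      simp [D2, mkDerivation_X]
  have e2 : D2 d (D1 d (X ⟨i, hi⟩)) = ((i:ℂ) * (d - i + 1)) • (X ⟨i, hi⟩ : MvPolynomial (Fin (d + 1)) ℂ) := by
    cases i with
    | zero => simp [D1, mkDerivation_X]
    | succ j =>
      have h : j < d := by omega
      simp [D1, D2, mkDerivation_X, h, smul_smul, Nat.cast_sub h.le]
      left
      ring
  rw [e1, e2, ← sub_smul]
  congr 1
  simp only
  ring

theorem H_D2 (d : ℕ) : ⁅⁅D1 d, D2 d⁆, D2 d⁆ = (-2 : ℂ) • D2 d := by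
  apply MvPolynomial.derivation_ext
  intro i
  rw [Derivation.commutator_apply, H_X]
  obtain ⟨i, hi⟩ := i
  have e : D2 d (X ⟨i, hi⟩) = if h : i < d then
      ((d:ℂ) - i) • (X (⟨i + 1, by omega⟩ : Fin (d + 1)) : MvPolynomial (Fin (d + 1)) ℂ)
    else 0 := by
    by_cases h : i < d
    · simp [D2, mkDerivation_X, h, Nat.cast_sub h.le]
    · simp [D2, mkDerivation_X, h]
  rw [Derivation.map_smul, Derivation.smul_apply, e]
  split_ifs with h
  · rw [Derivation.map_smul, H_X]
    simp only [smul_smul, ← sub_smul]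
    congr 1
    push_cast
    ring
  · simp

theorem H_iter (d : ℕ) (m : ℂ) (f : MvPolynomial (Fin (d + 1)) ℂ)
    (hf : ⁅D1 d, D2 d⁆ f = m • f) (i : ℕ) :
    ⁅D1 d, D2 d⁆ ((⇑(D2 d))^[i] f) = (m - 2 * i) • ((⇑(D2 d))^[i] f) := by
  induction i with
  | zero => simpa using hf
  | succ i ih =>
    rw [Function.iterate_succ_apply']
    set F := (⇑(D2 d))^[i] f
    have h := congrArg (fun D => D F) (H_D2 d)
    simp only [Derivation.smul_apply] at h
    rw [Derivation.commutator_apply, ih, Derivation.map_smul, sub_eq_iff_eq_add, ← add_smul] at h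
    rw [h]
    congr 1
    push_cast
    ring

theorem D1_iter (d : ℕ) (m : ℂ) (f : MvPolynomial (Fin (d + 1)) ℂ)
    (h0 : D1 d f = 0) (hf : ⁅D1 d, D2 d⁆ f = m • f) (i : ℕ) :
    D1 d ((⇑(D2 d))^[i] f) = (i * (m - i + 1)) • ((⇑(D2 d))^[i-1] f) := by
  induction i with
  | zero => simpa using h0
  | succ i ih =>
    have h := H_iter d m f hf i
    rw [Derivation.commutator_apply, ih, Derivation.map_smul, sub_eq_iff_eq_add] at h
    rw [Function.iterate_succ_apply', h]
    cases i with
    | zero => simp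
    | succ j =>
      simp only [Nat.add_sub_cancel, ← Function.iterate_succ_apply' (⇑(D2 d)), ← add_smul]
      congr 1
      push_cast
      ring

theorem coef (m k r i : ℕ) (hm : r ≤ m) (hk : r ≤ k) (hi : i < r) :
    ((-1 : ℂ) ^ (i+1) * (r.choose (i+1) : ℂ) * ((m - (i+1)).descFactorial (r - (i+1)) : ℂ) *
          ((k - r + (i+1)).descFactorial (i+1) : ℂ)) * (((i+1:ℕ):ℂ) * (m - (i+1:ℕ) + 1)) +
    ((-1 : ℂ) ^ i * (r.choose i : ℂ) * ((m - i).descFactorial (r - i) : ℂ) *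
          ((k - r + i).descFactorial i : ℂ)) * (((r-i:ℕ):ℂ) * (k - (r-i:ℕ) + 1)) = 0 := by
  obtain ⟨a, rfl⟩ : ∃ a, r = i + 1 + a := ⟨r - (i+1), by omega⟩
  obtain ⟨b, rfl⟩ := Nat.exists_eq_add_of_le hm
  obtain ⟨c, rfl⟩ := Nat.exists_eq_add_of_le hk
  have h1 : i + 1 + a + b - (i+1) = a + b := by omega
  have h2 : i + 1 + a - (i+1) = a := by omega
  have h3 : i + 1 + a + c - (i+1+a) = c := by omega
  have h4 : i + 1 + a + b - i = a + b + 1 := by omega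
  have h5 : i + 1 + a - i = a + 1 := by omega
  rw [h1, h2, h3, h4, h5, ← add_assoc c, Nat.succ_descFactorial_succ, Nat.succ_descFactorial_succ]
  have hc := Nat.choose_succ_right_eq (i+1+a) i
  rw [h5] at hc
  have hc' : ((i+1+a).choose (i+1) : ℂ) * (i+1) = (i+1+a).choose i * (a+1) := by exact_mod_cast hc
  push_cast
  rw [pow_succ]
  linear_combination (-(-1:ℂ)^i * ((a+b).descFactorial a) * ((c+i+1) * (c+i).descFactorial i) * (a+b+1)) * hc'

/-- **The semitransvectant of semi-invariants is a semi-invariant.**  If `f, g` are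
semi-invariants (`D1(f) = D1(g) = 0`) of weights `m, k`, and `0 ≤ r ≤ min(m,k)`, then
`S = Σ_{i=0}^{r} (−1)^i·binom(r,i)·[m−i]_{r−i}·[k−r+i]_i·D2^i(f)·D2^{r−i}(g)`
(where `[a]_j` is the falling factorial) satisfies `D1(S) = 0` and
`(D1∘D2 − D2∘D1)(S) = (m + k − 2r)·S`. -/
theorem semitransvectant_semiinvariant (d : ℕ) (hd : 2 ≤ d) (m k r : ℕ)
    (f g : MvPolynomial (Fin (d + 1)) ℂ)
    (hf1 : D1 d f = 0)
    (hf2 : D1 d (D2 d f) - D2 d (D1 d f) = (m : ℂ) • f)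
    (hg1 : D1 d g = 0)
    (hg2 : D1 d (D2 d g) - D2 d (D1 d g) = (k : ℂ) • g)
    (hr : r ≤ min m k)
    (S : MvPolynomial (Fin (d + 1)) ℂ)
    (hS : S = ∑ i ∈ Finset.range (r + 1),
      ((-1 : ℂ) ^ i * (r.choose i : ℂ) * ((m - i).descFactorial (r - i) : ℂ) *
          ((k - r + i).descFactorial i : ℂ)) •
        (((⇑(D2 d))^[i] f) * ((⇑(D2 d))^[r - i] g))) :
    D1 d S = 0 ∧
      D1 d (D2 d S) - D2 d (D1 d S) = ((m + k - 2 * r : ℕ) : ℂ) • S := by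
  have hm : r ≤ m := hr.trans (min_le_left _ _)
  have hk : r ≤ k := hr.trans (min_le_right _ _)
  rw [← Derivation.commutator_apply] at hf2 hg2
  constructor
  · rw [hS, map_sum]
    have key : ∀ i ∈ Finset.range (r + 1), D1 d (((-1 : ℂ) ^ i * (r.choose i : ℂ) * ((m - i).descFactorial (r - i) : ℂ) *
          ((k - r + i).descFactorial i : ℂ)) •
        (((⇑(D2 d))^[i] f) * ((⇑(D2 d))^[r - i] g))) =
        (((-1 : ℂ) ^ i * (r.choose i : ℂ) * ((m - i).descFactorial (r - i) : ℂ) *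
          ((k - r + i).descFactorial i : ℂ)) * ((i:ℂ) * (m - i + 1))) •
          (((⇑(D2 d))^[i-1] f) * ((⇑(D2 d))^[r - i] g)) +
        (((-1 : ℂ) ^ i * (r.choose i : ℂ) * ((m - i).descFactorial (r - i) : ℂ) *
          ((k - r + i).descFactorial i : ℂ)) * (((r-i:ℕ):ℂ) * (k - (r-i:ℕ) + 1))) •
          (((⇑(D2 d))^[i] f) * ((⇑(D2 d))^[r - i - 1] g)) := by
      intro i _
      rw [Derivation.map_smul, Derivation.leibniz, D1_iter d m f hf1 hf2, D1_iter d k g hg1 hg2,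
        ← smul_smul _ ((i:ℂ) * (m - i + 1)), ← smul_smul _ ((((r-i:ℕ):ℂ) * (k - (r-i:ℕ) + 1))), ← smul_add]
      congr 1
      rw [smul_eq_mul, smul_eq_mul, mul_smul_comm, mul_smul_comm,
        mul_comm ((⇑(D2 d))^[r - i] g)]
      exact add_comm _ _
    rw [Finset.sum_congr rfl key, Finset.sum_add_distrib, Finset.sum_range_succ',
      Finset.sum_range_succ (n := r)]
    simp only [Nat.sub_self, Nat.cast_zero, zero_mul, mul_zero, zero_smul, add_zero]
    rw [← Finset.sum_add_distrib]
    apply Finset.sum_eq_zero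
    intro i hi
    rw [Nat.add_sub_cancel, Nat.sub_sub r i 1, ← add_smul]
    rw [coef m k r i hm hk (Finset.mem_range.1 hi), zero_smul]
  · rw [← Derivation.commutator_apply, hS, map_sum, Finset.smul_sum]
    apply Finset.sum_congr rfl
    intro i hi
    have hi' : i ≤ r := by have := Finset.mem_range.1 hi; omega
    rw [Derivation.map_smul, Derivation.leibniz, H_iter d m f hf2, H_iter d k g hg2,
      smul_comm (((m + k - 2 * r : ℕ) : ℂ))]
    congr 1
    rw [smul_eq_mul, smul_eq_mul, mul_smul_comm, mul_smul_comm,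
        mul_comm ((⇑(D2 d))^[r - i] g), ← add_smul]
    congr 1
    rw [Nat.cast_sub hi', Nat.cast_sub (by omega)]
    push_cast
    ring
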